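/- Let p, q ≥ 2 be integers, n = p + q, and let a_i denote the coefficient of x^i in the shifted chromatic polynomial π(K_{p,q}, x + p). Then 2n·a_{n−4} − (n−2)·(a_{n−2})² = (1/6)(p² − p)q⁴ + ((1/2)p⁴ − (5/3)p³ + (11/6)p² − (2/3)p)q³ + (−(5/6)p⁵ + (5/3)p⁴ − (5/6)p³ − (1/3)p² + (1/3)p)q² + (−(1/6)p⁸ + (1/3)p⁶ + (1/2)p⁵ − (5/6)p⁴ − (1/6)p³ + (1/3)p²)q + (−(1/6)p⁹ + (1/2)p⁸ − (1/3)p⁷). -/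

import Mathlib

open Polynomial

/-- `P` is the chromatic polynomial of `G`: for every natural number `k`,
`P` evaluated at `k` equals the number of proper colorings of `G` with `k` colors. -/
def IsChromaticPoly {V : Type*} (G : SimpleGraph V) (P : Polynomial ℂ) : Prop :=
  ∀ k : ℕ, P.eval (k : ℂ) = Nat.card (G.Coloring (Fin k))

/-- The chromatic polynomial of `K_{p,q}`, built up one vertex of the first part at a time. -/
noncomputable def bipartiteChromatic : ℕ → ℕ → ℂ[X]
  | 0, q => X ^ q
  | p + 1, q => X * bipartiteChromatic p q +
      ∑ m ∈ Finset.range q,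
        C ((-1) ^ (m + 1) * (q.choose (m + 1) : ℂ)) * bipartiteChromatic p (q - m)

/-- A proper coloring of `K_{p,q}` colors the first part arbitrarily and the second part with the
remaining colors. -/
def completeBipartiteColoringEquiv (α β γ : Type*) :
    (completeBipartiteGraph α β).Coloring γ ≃
      (f : α → γ) × (β → {c : γ // c ∉ Set.range f}) where
  toFun F := ⟨fun i => F (Sum.inl i), fun j => ⟨F (Sum.inr j), by
    rintro ⟨i, hi⟩
    exact F.valid (show (completeBipartiteGraph α β).Adj (Sum.inl i) (Sum.inr j) by simp) hi⟩⟩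
  invFun s := SimpleGraph.Coloring.mk (Sum.elim s.1 fun j => (s.2 j).1) (by
    rintro (i | i) (j | j) h
    · simp at h
    · exact fun e => (s.2 j).2 ⟨i, e⟩
    · exact fun e => (s.2 i).2 ⟨j, e.symm⟩
    · simp at h)
  left_inv F := by
    ext (i | j) <;> rfl
  right_inv s := rfl

lemma card_completeBipartite_coloring (p q k : ℕ) :
    (Nat.card ((completeBipartiteGraph (Fin p) (Fin q)).Coloring (Fin k)) : ℂ) =
      ∑ f : Fin p → Fin k, ((k : ℂ) - (Finset.univ.image f).card) ^ q := by
  classical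
  rw [Nat.card_congr (completeBipartiteColoringEquiv _ _ _), Nat.card_eq_fintype_card,
    Fintype.card_sigma, Nat.cast_sum]
  refine Finset.sum_congr rfl fun f _ => ?_
  have h : Fintype.card {c : Fin k // c ∉ Set.range f} = k - (Finset.univ.image f).card := by
    rw [Fintype.card_subtype_compl, Fintype.card_fin, ← Set.toFinset_range, Set.toFinset_card]
  rw [Fintype.card_fun, h, Fintype.card_fin, Nat.cast_pow, Nat.cast_sub]
  simpa using Finset.card_le_univ (Finset.univ.image f)

lemma sum_pow_sub_card_insert {k : ℕ} (s : Finset (Fin k)) (q : ℕ) :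
    ∑ c : Fin k, ((k : ℂ) - (insert c s).card) ^ q =
      (s.card : ℂ) * ((k : ℂ) - s.card) ^ q +
        ((k : ℂ) - s.card) * ((k : ℂ) - s.card - 1) ^ q := by
  rw [← Finset.sum_add_sum_compl s]
  congr 1
  · rw [Finset.sum_congr rfl fun c hc => by rw [Finset.insert_eq_of_mem hc]]
    simp
  · rw [Finset.sum_congr rfl fun c hc => by
      rw [Finset.card_insert_of_notMem (Finset.mem_compl.1 hc)]]
    rw [Finset.sum_const, Finset.card_compl, Fintype.card_fin, nsmul_eq_mul, Nat.cast_sub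
      (by simpa using Finset.card_le_univ s)]
    push_cast
    ring

lemma mul_sub_one_pow (y : ℂ) (q : ℕ) :
    y * (y - 1) ^ q = y * y ^ q +
      ∑ m ∈ Finset.range q, (-1) ^ (m + 1) * (q.choose (m + 1) : ℂ) * y ^ (q - m) := by
  rw [sub_eq_neg_add, add_pow, Finset.sum_range_succ', mul_add, Finset.mul_sum, add_comm]
  congr 1
  · simp
  · refine Finset.sum_congr rfl fun m hm => ?_
    obtain ⟨r, rfl⟩ := Nat.exists_eq_add_of_lt (Finset.mem_range.1 hm)
    rw [show m + r + 1 - (m + 1) = r by omega, show m + r + 1 - m = r + 1 by omega]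
    ring

lemma eval_bipartiteChromatic (k p q : ℕ) :
    (bipartiteChromatic p q).eval (k : ℂ) =
      ∑ f : Fin p → Fin k, ((k : ℂ) - (Finset.univ.image f).card) ^ q := by
  induction p generalizing q with
  | zero => simp [bipartiteChromatic]
  | succ p ih =>
    rw [← (Fin.consEquiv fun _ => Fin k).sum_comp, Fintype.sum_prod_type_right]
    have h (f : Fin p → Fin k) :
        ∑ c : Fin k, ((k : ℂ) -
          (Finset.univ.image (Fin.consEquiv (fun _ => Fin k) (c, f))).card) ^ q =
        k * ((k : ℂ) - (Finset.univ.image f).card) ^ q +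
          ∑ m ∈ Finset.range q, (-1) ^ (m + 1) * (q.choose (m + 1) : ℂ) *
            ((k : ℂ) - (Finset.univ.image f).card) ^ (q - m) := by
      have him (c : Fin k) : Finset.univ.image (Fin.consEquiv (fun _ => Fin k) (c, f)) =
          insert c (Finset.univ.image f) := by
        ext x
        simp [Fin.exists_fin_succ, eq_comm]
      simp only [him]
      rw [sum_pow_sub_card_insert, mul_sub_one_pow]
      ring
    simp only [h, Finset.sum_add_distrib, ← Finset.mul_sum]
    rw [Finset.sum_comm]
    simp only [← Finset.mul_sum, ← ih, bipartiteChromatic, eval_add, eval_mul, eval_X,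
      eval_finsetSum, eval_C]

lemma IsChromaticPoly.eq_bipartiteChromatic {p q : ℕ} {P : ℂ[X]}
    (hP : IsChromaticPoly (completeBipartiteGraph (Fin p) (Fin q)) P) :
    P = bipartiteChromatic p q := by
  refine Polynomial.eq_of_infinite_eval_eq _ _ <|
    (Set.infinite_range_of_injective (Nat.cast_injective (R := ℂ))).mono ?_
  rintro _ ⟨k, rfl⟩
  rw [Set.mem_ofPred_eq, hP k, card_completeBipartite_coloring, eval_bipartiteChromatic]

lemma natDegree_bipartiteChromatic_le (p q : ℕ) :
    (bipartiteChromatic p q).natDegree ≤ p + q := by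
  induction p generalizing q with
  | zero => simp [bipartiteChromatic]
  | succ p ih =>
    rw [bipartiteChromatic]
    refine natDegree_add_le_of_degree_le ?_ (natDegree_sum_le_of_forall_le _ _ fun m _ => ?_)
    · exact (natDegree_mul_le_of_le natDegree_X_le (ih q)).trans (by omega)
    · exact (natDegree_C_mul_le _ _).trans ((ih _).trans (by omega))

/-- The coefficient of `x^(p + q - d)` in the chromatic polynomial of `K_{p,q}`, for `d ≤ 4`, as
a polynomial in `p` and `q`. -/
noncomputable def bipartiteTopCoeff (x y : ℂ) : ℕ → ℂ
  | 0 => 1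
  | 1 => -(x * y)
  | 2 => x * y * (x * y - 1) / 2
  | 3 => -(x * y * (x * y - 1) * (x * y - 2) / 6) + x * (x - 1) * y * (y - 1) / 4
  | 4 => x * y * (x * y - 1) * (x * y - 2) * (x * y - 3) / 24
      - x * (x - 1) * y * (y - 1) / 4 * (x * y - 3)
      + x * (x - 1) * y * (y - 1) * (y - 2) / 12 + x * (x - 1) * (x - 2) * y * (y - 1) / 12
  | _ => 0

lemma cast_choose_four (q : ℕ) :
    (q.choose 4 : ℂ) = q * (q - 1) * (q - 2) * (q - 3) / 24 := by
  rw [Nat.cast_choose_eq_descPochhammer_div]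
  simp [descPochhammer_succ_right, Nat.factorial]

lemma cast_choose_three (q : ℕ) : (q.choose 3 : ℂ) = q * (q - 1) * (q - 2) / 6 := by
  rw [Nat.cast_choose_eq_descPochhammer_div]
  simp [descPochhammer_succ_right, Nat.factorial]

/-- The factor `X ^ 4` keeps the index `p + q + 4 - d` from being truncated. -/
lemma coeff_X_pow_mul_bipartiteChromatic (p q d : ℕ) (hd : d ≤ 4) :
    (X ^ 4 * bipartiteChromatic p q).coeff (p + q + 4 - d) = bipartiteTopCoeff p q d := by
  induction p generalizing q d with
  | zero =>
    rw [bipartiteChromatic, ← pow_add, coeff_X_pow]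
    interval_cases d <;> simp [bipartiteTopCoeff] <;> omega
  | succ p ih =>
    have hterm (m : ℕ) : (q.choose (m + 1) : ℂ) *
        (X ^ 4 * bipartiteChromatic p (q - m)).coeff (p + 1 + q + 4 - d) =
        if m + 1 ≤ d then
          (q.choose (m + 1) : ℂ) * bipartiteTopCoeff p (q - m) (d - (m + 1)) else 0 := by
      rcases lt_or_ge q (m + 1) with hm | hm
      · simp [Nat.choose_eq_zero_of_lt hm]
      split_ifs with hmd
      · rw [← Nat.cast_sub (by omega), ← ih (q - m) (d - (m + 1)) (by omega)]
        congr 2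
        omega
      · rw [coeff_eq_zero_of_natDegree_lt, mul_zero]
        refine (natDegree_mul_le_of_le (natDegree_X_pow_le 4)
          (natDegree_bipartiteChromatic_le p (q - m))).trans_lt ?_
        omega
    have hsum : (X ^ 4 * bipartiteChromatic (p + 1) q).coeff (p + 1 + q + 4 - d) =
        bipartiteTopCoeff p q d + ∑ m ∈ Finset.range 4, (-1) ^ (m + 1) *
          if m + 1 ≤ d then
            (q.choose (m + 1) : ℂ) * bipartiteTopCoeff p (q - m) (d - (m + 1)) else 0 := by
      have hshift : p + 1 + q + 4 - d = p + q + 4 - d + 1 := by omega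
      rw [bipartiteChromatic, mul_add, coeff_add, Finset.mul_sum, finsetSum_coeff]
      congr 1
      · rw [mul_left_comm, hshift, coeff_X_mul, ih q d hd]
      · have hcoeff (m : ℕ) : (X ^ 4 * (C ((-1) ^ (m + 1) * (q.choose (m + 1) : ℂ)) *
            bipartiteChromatic p (q - m))).coeff (p + 1 + q + 4 - d) = (-1) ^ (m + 1) *
            if m + 1 ≤ d then
              (q.choose (m + 1) : ℂ) * bipartiteTopCoeff p (q - m) (d - (m + 1)) else 0 := by
          rw [mul_left_comm, coeff_C_mul, mul_assoc, hterm]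
        simp only [hcoeff]
        rcases le_total q 4 with h4 | h4
        · refine Finset.sum_subset (Finset.range_mono h4) fun m _ hm => ?_
          rw [Nat.choose_eq_zero_of_lt (by simpa [Nat.lt_succ_iff] using hm)]
          simp
        · refine (Finset.sum_subset (Finset.range_mono h4) fun m _ hm => ?_).symm
          rw [if_neg (by simp at hm; omega), mul_zero]
    rw [hsum]
    interval_cases d <;>
      simp [Finset.sum_range_succ, bipartiteTopCoeff, Nat.cast_choose_two, cast_choose_three,
        cast_choose_four] <;> ring

lemma coeff_bipartiteChromatic {p q d : ℕ} (hd : d ≤ 4) (hdn : d ≤ p + q) :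
    (bipartiteChromatic p q).coeff (p + q - d) = bipartiteTopCoeff p q d := by
  rw [← coeff_X_pow_mul_bipartiteChromatic p q d hd,
    show p + q + 4 - d = p + q - d + 4 by omega, coeff_X_pow_mul]

/-- Taylor expansion of the coefficient of `x^(n - e)` of a shifted polynomial of degree at
most `n`. -/
lemma coeff_comp_X_add_C_of_natDegree_le {R : Type*} [CommSemiring R] {f : R[X]} {n e : ℕ}
    (hf : f.natDegree ≤ n) (he : e ≤ n) (r : R) :
    (f.comp (X + C r)).coeff (n - e) =
      ∑ j ∈ Finset.range (e + 1), ((n - e + j).choose j : R) * f.coeff (n - e + j) * r ^ j := by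
  rw [← taylor_apply, taylor_coeff, eval_eq_sum_range' (n := e + 1)]
  · refine Finset.sum_congr rfl fun j _ => ?_
    rw [hasseDeriv_coeff, add_comm j, Nat.choose_symm_add]
  · exact (natDegree_hasseDeriv_le _ _).trans_lt (by omega)

/-- Let `p, q ≥ 2`, `n = p + q`, and let `a i` be the coefficient of `x^i` in the shifted
chromatic polynomial `π(K_{p,q}, x + p)`. Then `2n a_{n-4} - (n-2) a_{n-2}²` equals the stated
quartic polynomial in `q` with coefficients polynomial in `p`. -/
theorem shifted_chromatic_coeff_identity (p q : ℕ) (hp : 2 ≤ p) (hq : 2 ≤ q)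
    (n : ℕ) (hn : n = p + q)
    (P : Polynomial ℂ) (hP : IsChromaticPoly (completeBipartiteGraph (Fin p) (Fin q)) P)
    (a : ℕ → ℂ) (ha : ∀ i, a i = (P.comp (X + C (p : ℂ))).coeff i) :
    2 * (n : ℂ) * a (n - 4) - ((n : ℂ) - 2) * (a (n - 2)) ^ 2 =
      (1 / 6 * (p : ℂ) ^ 2 - 1 / 6 * (p : ℂ)) * (q : ℂ) ^ 4
      + (1 / 2 * (p : ℂ) ^ 4 - 5 / 3 * (p : ℂ) ^ 3 + 11 / 6 * (p : ℂ) ^ 2 - 2 / 3 * (p : ℂ))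
        * (q : ℂ) ^ 3
      + (-(5 / 6) * (p : ℂ) ^ 5 + 5 / 3 * (p : ℂ) ^ 4 - 5 / 6 * (p : ℂ) ^ 3
          - 1 / 3 * (p : ℂ) ^ 2 + 1 / 3 * (p : ℂ)) * (q : ℂ) ^ 2
      + (-(1 / 6) * (p : ℂ) ^ 8 + 1 / 3 * (p : ℂ) ^ 6 + 1 / 2 * (p : ℂ) ^ 5
          - 5 / 6 * (p : ℂ) ^ 4 - 1 / 6 * (p : ℂ) ^ 3 + 1 / 3 * (p : ℂ) ^ 2) * (q : ℂ)
      + (-(1 / 6) * (p : ℂ) ^ 9 + 1 / 2 * (p : ℂ) ^ 8 - 1 / 3 * (p : ℂ) ^ 7) := by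
  subst hn
  have hn4 : 4 ≤ p + q := by omega
  have hdeg := natDegree_bipartiteChromatic_le p q
  have hcoeff (d : ℕ) (hd : d ≤ 4) := coeff_bipartiteChromatic (p := p) (q := q) hd (hd.trans hn4)
  rw [ha, ha, hP.eq_bipartiteChromatic, coeff_comp_X_add_C_of_natDegree_le hdeg hn4,
    coeff_comp_X_add_C_of_natDegree_le hdeg (by omega)]
  simp only [Finset.sum_range_succ, Finset.sum_range_zero]
  rw [show p + q - 4 + 0 = p + q - 4 by omega, show p + q - 4 + 1 = p + q - 3 by omega,
    show p + q - 4 + 2 = p + q - 2 by omega, show p + q - 4 + 3 = p + q - 1 by omega,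
    show p + q - 4 + 4 = p + q - 0 by omega, show p + q - 2 + 0 = p + q - 2 by omega,
    show p + q - 2 + 1 = p + q - 1 by omega, show p + q - 2 + 2 = p + q - 0 by omega,
    hcoeff 0 (by omega), hcoeff 1 (by omega), hcoeff 2 (by omega), hcoeff 3 (by omega),
    hcoeff 4 (by omega), cast_choose_four, cast_choose_three]
  simp only [Nat.choose_zero_right, Nat.choose_one_right, Nat.cast_choose_two, bipartiteTopCoeff]
  rw [Nat.sub_zero, Nat.cast_sub (show 1 ≤ p + q by omega), Nat.cast_sub (show 2 ≤ p + q by omega),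
    Nat.cast_sub (show 3 ≤ p + q by omega)]
  push_cast
  ring
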